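/- arXiv:2508.08017 — 7 statements merged into one kernel-verified Lean document; each statement's English description precedes it below -/
import Mathlib

section
/- Let (X,d) be a separable metric space. Then there exists a countable set D of real-valued Lipschitz functions on X with the following property: for every Lipschitz function f : X → ℝ there is a sequence (f_n)_{n∈ℕ} of elements of D such that f_n(x) → f(x) for every x ∈ X and, for every n, f_n is K-Lipschitz for every constant K such that f is K-Lipschitz (i.e. the optimal Lipschitz constant of each f_n is at most that of f). -/
open Filter Topology

/-- A Lipschitz function has a least Lipschitz constant. -/
lemma exists_least_lipschitz {X : Type*} [MetricSpace X] (f : X → ℝ)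
    (h : ∃ K : NNReal, LipschitzWith K f) :
    ∃ L : NNReal, LipschitzWith L f ∧ ∀ K : NNReal, LipschitzWith K f → L ≤ K := by
  have hc : IsClosed {K : NNReal | LipschitzWith K f} := by
    simp only [lipschitzWith_iff_dist_le_mul, Set.ofPred_forall]
    refine isClosed_iInter fun x => isClosed_iInter fun y => ?_
    exact isClosed_le (by fun_prop) (by fun_prop)
  exact ⟨sInf {K : NNReal | LipschitzWith K f}, hc.csInf_mem h (OrderBot.bddBelow _),
    fun K hK => csInf_le (OrderBot.bddBelow _) hK⟩

/-- Lemma A.1 of the paper.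
Let `(X,d)` be a separable metric space.  Then there is a countable set `D` of real-valued
Lipschitz functions on `X` such that every Lipschitz `f : X → ℝ` is the pointwise limit of a
sequence `(f_n) ⊆ D` with each `f_n` being `K`-Lipschitz for every `K` such that `f` is
`K`-Lipschitz. -/
theorem exists_countable_lipschitz_dense_pointwise
    {X : Type*} [MetricSpace X] [TopologicalSpace.SeparableSpace X] :
    ∃ D : Set (X → ℝ), D.Countable ∧
      ∀ f : X → ℝ, (∃ K : NNReal, LipschitzWith K f) →
        ∃ u : ℕ → (X → ℝ),
          (∀ n, u n ∈ D) ∧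
          (∀ x : X, Tendsto (fun n => u n x) atTop (𝓝 (f x))) ∧
          (∀ n, ∀ K : NNReal, LipschitzWith K f → LipschitzWith K (u n)) := by
  obtain ⟨s, hsc, hsd⟩ := TopologicalSpace.exists_countable_dense X
  have : Countable s := hsc.to_subtype
  let r : (X → ℝ) → (s → ℝ) := fun f i => f i
  have hr : Continuous r := by fun_prop
  let S : ℚ → Set (X → ℝ) := fun q => {g | LipschitzWith (Real.toNNReal q) g}
  have hA : ∀ q, ∃ A : Set (X → ℝ), A ⊆ S q ∧ A.Countable ∧ r '' S q ⊆ closure (r '' A) := by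
    intro q
    obtain ⟨t, hts, htc, htd⟩ :=
      (TopologicalSpace.IsSeparable.of_separableSpace (r '' S q)).exists_countable_dense_subset
    obtain ⟨A, hAS, hAc, hAt⟩ : ∃ A ⊆ S q, A.Countable ∧ r '' A = t := by
      have hts2 : ∀ y, y ∈ t → ∃ h, h ∈ S q ∧ r h = y := fun y hy => hts hy
      choose! g hg using hts2
      refine ⟨g '' t, ?_, htc.image g, ?_⟩
      · rintro _ ⟨y, hy, rfl⟩
        exact (hg _ hy).1
      · ext y
        constructor
        · rintro ⟨_, ⟨z, hz, rfl⟩, rfl⟩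
          rw [(hg _ hz).2]; exact hz
        · intro hy
          exact ⟨g y, ⟨y, hy, rfl⟩, (hg _ hy).2⟩
    exact ⟨A, hAS, hAc, hAt ▸ htd⟩
  choose A hAS hAc hAd using hA
  refine ⟨⋃ q, A q, Set.countable_iUnion hAc, fun f hf => ?_⟩
  obtain ⟨L, hL, hmin⟩ := exists_least_lipschitz f hf
  let B : Set (X → ℝ) := {g | (∃ q, g ∈ A q) ∧ LipschitzWith L g}
  have key : ∀ (q : ℚ) (g : X → ℝ), Real.toNNReal q ≤ L → LipschitzWith (Real.toNNReal q) g →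
      r g ∈ closure (r '' B) := by
    intro q g hq hg
    refine closure_mono (Set.image_mono ?_) (hAd q ⟨g, hg, rfl⟩)
    intro a ha
    exact ⟨⟨q, ha⟩, (hAS q ha).weaken hq⟩
  have hmem : r f ∈ closure (r '' B) := by
    rcases eq_or_ne L 0 with h0 | h0
    · apply key 0 f (by simp)
      simpa [h0] using hL
    · have hLpos : (0 : ℝ) < L := by exact_mod_cast pos_iff_ne_zero.2 h0
      have ht : Tendsto (fun c : ℝ => r (fun x => c * f x)) (𝓝[<] 1) (𝓝 (r f)) := by
        have : Continuous (fun c : ℝ => r (fun x => c * f x)) := by fun_prop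
        have h1 := this.tendsto 1
        simp only [one_mul] at h1
        exact h1.mono_left nhdsWithin_le_nhds
      rw [← closure_closure]
      refine mem_closure_of_tendsto ht ?_
      filter_upwards [Ioo_mem_nhdsLT (show (0 : ℝ) < 1 by norm_num)] with c hc
      obtain ⟨q, hq1, hq2⟩ := exists_rat_btwn (show c * (L : ℝ) < L by nlinarith [hc.2])
      have hq0 : (0 : ℝ) ≤ q := by nlinarith [hc.1, mul_pos hc.1 hLpos]
      refine key q (fun x => c * f x) (Real.toNNReal_le_iff_le_coe.2 hq2.le) ?_
      refine LipschitzWith.of_dist_le_mul fun x y => ?_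
      rw [Real.coe_toNNReal _ hq0, Real.dist_eq, ← mul_sub, abs_mul, abs_of_pos hc.1]
      have h2 := hL.dist_le_mul x y
      rw [Real.dist_eq] at h2
      calc c * |f x - f y| ≤ c * (L * dist x y) := by gcongr; exact hc.1.le
        _ = c * L * dist x y := by ring
        _ ≤ q * dist x y := by gcongr
  obtain ⟨v, hv, hvt⟩ := mem_closure_iff_seq_limit.1 hmem
  choose u hu huv using hv
  refine ⟨u, fun n => Set.mem_iUnion.2 (hu n).1, fun x => ?_,
    fun n K hK => (hu n).2.weaken (hmin K hK)⟩
  have hpt : ∀ i : s, Tendsto (fun n => u n i) atTop (𝓝 (f i)) := by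
    intro i
    have := (tendsto_pi_nhds.1 hvt) i
    simpa only [← huv] using this
  rw [Metric.tendsto_atTop]
  intro ε hε
  obtain ⟨y, hys, hy⟩ := hsd.exists_dist_lt x (show 0 < ε / (3 * (L + 1)) by positivity)
  have hy' : L * dist x y < ε / 3 := by
    rw [lt_div_iff₀ (by positivity)] at hy
    nlinarith [dist_nonneg (x := x) (y := y), L.coe_nonneg]
  obtain ⟨N, hN⟩ := Metric.tendsto_atTop.1 (hpt ⟨y, hys⟩) (ε / 3) (by positivity)
  refine ⟨N, fun n hn => ?_⟩
  have h1 := hN n hn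
  have h2 := (hu n).2.dist_le_mul x y
  have h3 := hL.dist_le_mul x y
  have h4 := dist_triangle4 (u n x) (u n y) (f y) (f x)
  rw [dist_comm (f y)] at h4
  simp only at h1
  linarith
end

section
/- Let (X,d) be a separable metric space, let π : X → ℝ be Lipschitz, and let ε > 0. Then there exists a countable family {E_n}_{n∈ℕ} of pairwise disjoint Borel subsets of X with ⋃_n E_n = X such that for every n, every x ∈ E_n, and all y, z ∈ E_n one has |π(y) − π(z)| ≤ (Lip π(x) + 2ε)·d(y,z); that is, the restriction of π to E_n is (Lip π(x) + 2ε)-Lipschitz for every x ∈ E_n. -/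
open Filter Topology
open scoped Classical

/-- The pointwise Lipschitz constant of `π` at `x`:
`Lip π(x) := limsup_{y → x} |π x − π y| / d(x,y)` when `x` is a limit point of `X`,
and `0` when `x` is isolated. -/
noncomputable def pointwiseLip {X : Type*} [MetricSpace X] (π : X → ℝ) (x : X) : ℝ :=
  if (𝓝[≠] x).NeBot then
    Filter.limsup (fun y => |π x - π y| / dist x y) (𝓝[≠] x)
  else 0

/-- Points where `π` is `c`-Lipschitz at scale `r`. -/
def lipSet {X : Type*} [MetricSpace X] (π : X → ℝ) (c r : ℝ) : Set X :=
  {x | ∀ y, dist x y < r → |π x - π y| ≤ c * dist x y}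

lemma isClosed_lipSet {X : Type*} [MetricSpace X] (π : X → ℝ) (hπ : Continuous π) (c r : ℝ) :
    IsClosed (lipSet π c r) := by
  have : lipSet π c r = ⋂ y, ({x | r ≤ dist x y} ∪ {x | |π x - π y| ≤ c * dist x y}) := by
    ext x
    simp only [lipSet, Set.mem_ofPred_eq, Set.mem_iInter, Set.mem_union]
    refine forall_congr' fun y => ?_
    rw [imp_iff_not_or, not_lt]
  rw [this]
  refine isClosed_iInter fun y => IsClosed.union ?_ ?_
  · exact isClosed_le (by fun_prop) (by fun_prop)
  · exact isClosed_le (by fun_prop) (by fun_prop)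

lemma lip_bdd {X : Type*} [MetricSpace X] (π : X → ℝ) (K : NNReal) (hπ : LipschitzWith K π)
    (x y : X) : |π x - π y| / dist x y ≤ K := by
  have h := hπ.dist_le_mul x y
  rw [Real.dist_eq] at h
  exact div_le_of_le_mul₀ dist_nonneg K.2 h

lemma pointwiseLip_nonneg {X : Type*} [MetricSpace X] (π : X → ℝ) (K : NNReal)
    (hπ : LipschitzWith K π) (x : X) : 0 ≤ pointwiseLip π x := by
  unfold pointwiseLip
  split_ifs with h
  · refine le_limsup_of_frequently_le (Eventually.frequently
      (Eventually.of_forall fun y => by positivity)) ?_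
    exact isBoundedUnder_of ⟨K, fun y => lip_bdd π K hπ x y⟩
  · exact le_rfl

lemma mem_lipSet_of_lt {X : Type*} [MetricSpace X] (π : X → ℝ) (K : NNReal)
    (hπ : LipschitzWith K π) (x : X) (c : ℝ) (hc : pointwiseLip π x < c) :
    ∃ m : ℕ, x ∈ lipSet π c (1 / ((m : ℝ) + 1)) := by
  have hev : ∀ᶠ y in 𝓝[≠] x, |π x - π y| / dist x y < c := by
    unfold pointwiseLip at hc
    split_ifs at hc with h
    · exact eventually_lt_of_limsup_lt hc
        (isBoundedUnder_of ⟨K, fun y => lip_bdd π K hπ x y⟩)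
    · rw [not_neBot] at h
      rw [h]
      exact eventually_bot
  rw [eventually_nhdsWithin_iff, Metric.eventually_nhds_iff] at hev
  obtain ⟨δ, hδ, H⟩ := hev
  obtain ⟨m, hm⟩ := exists_nat_one_div_lt hδ
  refine ⟨m, fun y hy => ?_⟩
  by_cases hxy : y = x
  · subst hxy; simp
  · have h1 := H (y := y) (by rw [dist_comm]; linarith) hxy
    have h2 : 0 < dist x y := dist_pos.2 (Ne.symm hxy)
    exact ((div_lt_iff₀ h2).1 h1).le

/-- Points lying at a level lower than `k`. -/
def lowSet {X : Type*} [MetricSpace X] (π : X → ℝ) (ε : ℝ) (k : ℕ) : Set X :=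
  ⋃ j : ℕ, ⋃ _ : j < k, ⋃ m : ℕ, lipSet π (((j : ℝ) + 1) * ε) (1 / ((m : ℝ) + 1))

lemma le_pointwiseLip {X : Type*} [MetricSpace X] (π : X → ℝ) (K : NNReal)
    (hπ : LipschitzWith K π) (ε : ℝ) (k : ℕ) (x : X) (hx : x ∉ lowSet π ε k) :
    k * ε ≤ pointwiseLip π x := by
  cases k with
  | zero => simpa using pointwiseLip_nonneg π K hπ x
  | succ j =>
    by_contra hlt
    push Not at hlt
    obtain ⟨m, hm⟩ := mem_lipSet_of_lt π K hπ x _ hlt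
    apply hx
    simp only [lowSet, Set.mem_iUnion]
    exact ⟨j, Nat.lt_succ_self j, m, by push_cast at hm; exact hm⟩

/-- decomposition step in the proof of Proposition 2.3 of the paper.
Let `X` be a separable metric space, `π : X → ℝ` Lipschitz, `ε > 0`.  Then there is a countable
Borel partition `{E n}` of `X` such that on each `E n` the restriction of `π` is
`(Lip π(x) + 2ε)`-Lipschitz for every `x ∈ E n`. -/
theorem exists_borel_partition_pointwise_lipschitz
    {X : Type*} [MetricSpace X] [TopologicalSpace.SeparableSpace X]
    [MeasurableSpace X] [BorelSpace X]
    (π : X → ℝ) (K : NNReal) (hπ : LipschitzWith K π) (ε : ℝ) (hε : 0 < ε) :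
    ∃ E : ℕ → Set X,
      (∀ n, MeasurableSet (E n)) ∧
      Pairwise (Function.onFun Disjoint E) ∧
      (⋃ n, E n) = Set.univ ∧
      ∀ n, ∀ x ∈ E n, ∀ y ∈ E n, ∀ z ∈ E n,
        |π y - π z| ≤ (pointwiseLip π x + 2 * ε) * dist y z := by
  rcases isEmpty_or_nonempty X with hX | hX
  · refine ⟨fun _ => ∅, fun _ => MeasurableSet.empty, fun i j _ => by simp [Function.onFun],
      Subsingleton.elim _ _, fun n x => (hX.false x).elim⟩
  let S : ℕ × ℕ × ℕ → Set X := fun p =>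
    (lipSet π (((p.1 : ℝ) + 1) * ε) (1 / ((p.2.1 : ℝ) + 1)) ∩
      Metric.ball (TopologicalSpace.denseSeq X p.2.2) (1 / ((p.2.1 : ℝ) + 1) / 2)) \
      lowSet π ε p.1
  have hS : ∀ p, MeasurableSet (S p) := by
    intro p
    refine MeasurableSet.diff (MeasurableSet.inter
      (isClosed_lipSet π hπ.continuous _ _).measurableSet Metric.isOpen_ball.measurableSet) ?_
    exact MeasurableSet.iUnion fun j => MeasurableSet.iUnion fun _ => MeasurableSet.iUnion fun m =>
      (isClosed_lipSet π hπ.continuous _ _).measurableSet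
  have hcov : ∀ x, ∃ p, x ∈ S p := by
    intro x
    have hex : ∃ k : ℕ, ∃ m : ℕ, x ∈ lipSet π (((k : ℝ) + 1) * ε) (1 / ((m : ℝ) + 1)) := by
      obtain ⟨k, hk⟩ := exists_nat_gt (pointwiseLip π x / ε)
      refine ⟨k, mem_lipSet_of_lt π K hπ x _ ?_⟩
      rw [div_lt_iff₀ hε] at hk
      linarith
    obtain ⟨m, hm⟩ := Nat.find_spec hex
    have hr : (0 : ℝ) < 1 / ((m : ℝ) + 1) / 2 := by positivity
    obtain ⟨i, hi⟩ := (TopologicalSpace.denseRange_denseSeq X).exists_dist_lt x hr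
    refine ⟨(Nat.find hex, m, i), ⟨hm, hi⟩, ?_⟩
    intro hlow
    simp only [lowSet, Set.mem_iUnion] at hlow
    obtain ⟨j, hj, hjm⟩ := hlow
    exact Nat.find_min hex hj hjm
  let e : ℕ ≃ ℕ × ℕ × ℕ := (Denumerable.eqv (ℕ × ℕ × ℕ)).symm
  refine ⟨disjointed (fun n => S (e n)), fun n => ?_, disjoint_disjointed _, ?_, ?_⟩
  · exact MeasurableSet.disjointed (fun n => hS (e n)) n
  · rw [iUnion_disjointed]
    refine Set.eq_univ_of_forall fun x => ?_
    obtain ⟨p, hp⟩ := hcov x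
    exact Set.mem_iUnion.2 ⟨e.symm p, by simpa using hp⟩
  · intro n x hx y hy z hz
    obtain ⟨-, hx2⟩ := disjointed_subset (fun n => S (e n)) n hx
    obtain ⟨⟨hy1, hy2⟩, -⟩ := disjointed_subset (fun n => S (e n)) n hy
    obtain ⟨⟨-, hz2⟩, -⟩ := disjointed_subset (fun n => S (e n)) n hz
    have hL := le_pointwiseLip π K hπ ε _ x hx2
    have hd : dist y z < 1 / (((e n).2.1 : ℝ) + 1) := by
      have := dist_triangle_right y z (TopologicalSpace.denseSeq X (e n).2.2)
      rw [Metric.mem_ball] at hy2 hz2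
      linarith
    refine (hy1 z hd).trans (mul_le_mul_of_nonneg_right ?_ dist_nonneg)
    linarith
end

section
/- Let (X,d) be a metric space, let γ : [0,1] → X be K-Lipschitz, let ε > 0, and let 0 = t₀ < t₁ < ⋯ < t_m = 1 be a partition with t_j − t_{j−1} ≤ ε for every j. Suppose c : [0,1] → X satisfies c(t_j) = γ(t_j) for every j and, for every j ∈ {1,…,m} and all u, v ∈ [t_{j−1}, t_j], d(c(u), c(v)) = (|u−v| / (t_j − t_{j−1}))·d(γ(t_{j−1}), γ(t_j)) (i.e. on each subinterval c is a constant-speed geodesic from γ(t_{j−1}) to γ(t_j)). Then: (i) d(c(t), γ(t)) ≤ 2Kε for every t ∈ [0,1]; and (ii) the length of c over [0,1] is at most the length of γ over [0,1]; more precisely, ℓ(c) = Σ_{j=1}^m d(γ(t_{j−1}), γ(t_j)) ≤ ℓ(γ). -/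
lemma eVariationOn_geodesic_le {X : Type*} [MetricSpace X] (c : ℝ → X) (a b D : ℝ)
    (hab : a < b) (hD : 0 ≤ D)
    (h : ∀ u ∈ Set.Icc a b, ∀ v ∈ Set.Icc a b, dist (c u) (c v) = (|u - v| / (b - a)) * D) :
    eVariationOn c (Set.Icc a b) ≤ ENNReal.ofReal D := by
  have hba : 0 < b - a := sub_pos.2 hab
  unfold eVariationOn
  refine iSup_le ?_
  rintro ⟨n, u, hu, us⟩
  have h1 : ∀ i ∈ Finset.range n, edist (c (u (i + 1))) (c (u i))
      = ENNReal.ofReal ((u (i + 1) - u i) * (D / (b - a))) := by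
    intro i _
    rw [edist_dist, h _ (us _) _ (us _), abs_of_nonneg (sub_nonneg.2 (hu (Nat.le_succ i)))]
    congr 1
    ring
  have h2 : 0 ≤ D / (b - a) := by positivity
  simp only
  rw [Finset.sum_congr rfl h1, ← ENNReal.ofReal_sum_of_nonneg, ← Finset.sum_mul,
    Finset.sum_range_sub]
  · apply ENNReal.ofReal_le_ofReal
    calc (u n - u 0) * (D / (b - a)) ≤ (b - a) * (D / (b - a)) := by
          apply mul_le_mul_of_nonneg_right _ h2
          linarith [(us n).2, (us 0).1]
      _ = D := by field_simp
  · intro i _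
    exact mul_nonneg (sub_nonneg.2 (hu (Nat.le_succ i))) h2

/-- Step 2 of Theorem 4.5 of the paper: piecewise-geodesic interpolation.
Let `γ : [0,1] → X` be `K`-Lipschitz, `ε > 0`, and let `0 = t₀ < t₁ < ⋯ < t_m = 1` be a
partition with mesh at most `ε`.  If `c` agrees with `γ` at the nodes and is a constant-speed
geodesic from `γ(t_{j−1})` to `γ(t_j)` on each subinterval, then `d(c s, γ s) ≤ 2Kε` on
`[0,1]`, and `ℓ(c) = Σ_j d(γ(t_{j−1}), γ(t_j)) ≤ ℓ(γ)`. -/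
theorem piecewise_geodesic_interpolation
    {X : Type*} [MetricSpace X] (γ c : ℝ → X) (K : NNReal)
    (hγ : LipschitzOnWith K γ (Set.Icc 0 1))
    (ε : ℝ) (hε : 0 < ε) (m : ℕ) (hm : 0 < m) (t : ℕ → ℝ)
    (ht0 : t 0 = 0) (htm : t m = 1)
    (hmono : ∀ j < m, t j < t (j + 1))
    (hmesh : ∀ j < m, t (j + 1) - t j ≤ ε)
    (hnodes : ∀ j ≤ m, c (t j) = γ (t j))
    (hgeo : ∀ j < m, ∀ u ∈ Set.Icc (t j) (t (j + 1)), ∀ v ∈ Set.Icc (t j) (t (j + 1)),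
      dist (c u) (c v) = (|u - v| / (t (j + 1) - t j)) * dist (γ (t j)) (γ (t (j + 1)))) :
    (∀ s ∈ Set.Icc (0:ℝ) 1, dist (c s) (γ s) ≤ 2 * (K : ℝ) * ε) ∧
    eVariationOn c (Set.Icc 0 1)
      = ∑ j ∈ Finset.range m, ENNReal.ofReal (dist (γ (t j)) (γ (t (j + 1)))) ∧
    eVariationOn c (Set.Icc 0 1) ≤ eVariationOn γ (Set.Icc 0 1) := by
  set T : ℕ → ℝ := fun j => t (min j m) with hT
  have hTmono : Monotone T := by
    apply monotone_nat_of_le_succ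
    intro j
    simp only [hT]
    rcases lt_or_ge j m with hj | hj
    · rw [min_eq_left hj.le, min_eq_left (Nat.succ_le_of_lt hj)]
      exact (hmono j hj).le
    · rw [min_eq_right hj, min_eq_right (by omega)]
  have hTeq : ∀ j ≤ m, T j = t j := fun j hj => by simp only [hT, min_eq_left hj]
  have hT01 : ∀ j, T j ∈ Set.Icc (0 : ℝ) 1 := by
    intro j
    constructor
    · rw [← ht0, ← hTeq 0 (Nat.zero_le _)]
      exact hTmono (Nat.zero_le _)
    · rw [← htm, ← hTeq m le_rfl]
      have : T j = T (min j m) := by simp [hT]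
      rw [this]
      exact hTmono (min_le_right _ _)
  have ht01 : ∀ j ≤ m, t j ∈ Set.Icc (0 : ℝ) 1 := fun j hj => hTeq j hj ▸ hT01 j
  have hsplit : ∀ f : ℝ → X, eVariationOn f (Set.Icc 0 1)
      = ∑ j ∈ Finset.range m, eVariationOn f (Set.Icc (t j) (t (j + 1))) := by
    intro f
    have h := eVariationOn.sum' f hTmono (n := m)
    rw [hTeq 0 (Nat.zero_le _), hTeq m le_rfl, ht0, htm] at h
    rw [← h]
    refine Finset.sum_congr rfl fun j hj => ?_
    have hj := Finset.mem_range.1 hj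
    rw [hTeq j hj.le, hTeq (j + 1) hj]
  have hlow : ∀ f : ℝ → X, ∀ j < m, edist (f (t j)) (f (t (j + 1)))
      ≤ eVariationOn f (Set.Icc (t j) (t (j + 1))) := fun f j hj =>
    eVariationOn.edist_le f (Set.left_mem_Icc.2 (hmono j hj).le)
      (Set.right_mem_Icc.2 (hmono j hj).le)
  have hlen : eVariationOn c (Set.Icc 0 1)
      = ∑ j ∈ Finset.range m, ENNReal.ofReal (dist (γ (t j)) (γ (t (j + 1)))) := by
    rw [hsplit c]
    refine Finset.sum_congr rfl fun j hj => ?_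
    have hj := Finset.mem_range.1 hj
    apply le_antisymm
    · exact eVariationOn_geodesic_le c _ _ _ (hmono j hj) dist_nonneg (hgeo j hj)
    · have := hlow c j hj
      rwa [hnodes j hj.le, hnodes (j + 1) hj, edist_dist] at this
  refine ⟨?_, hlen, ?_⟩
  · intro s hs
    have hex : ∃ j < m, s ∈ Set.Icc (t j) (t (j + 1)) := by
      have hE : ∃ k, k ≤ m ∧ 0 < k ∧ s ≤ t k := ⟨m, le_rfl, hm, htm ▸ hs.2⟩
      classical
      obtain ⟨h1, h2, h3⟩ := Nat.find_spec hE
      obtain ⟨j, hj⟩ : ∃ j, Nat.find hE = j + 1 := ⟨Nat.find hE - 1, by omega⟩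
      rw [hj] at h1 h3
      refine ⟨j, h1, ?_, h3⟩
      rcases Nat.eq_zero_or_pos j with h0 | h0
      · rw [h0, ht0]; exact hs.1
      · have hn := Nat.find_min hE (m := j) (by omega)
        by_contra hlt
        exact hn ⟨by omega, h0, (not_le.1 hlt).le⟩
    obtain ⟨j, hj, hsj⟩ := hex
    have hpos : 0 < t (j + 1) - t j := sub_pos.2 (hmono j hj)
    have hl := Set.left_mem_Icc.2 (hmono j hj).le
    have hK : (0 : ℝ) ≤ K := K.2
    have e1 : dist (c s) (γ (t j)) ≤ K * ε := by
      rw [← hnodes j hj.le, hgeo j hj s hsj _ hl, abs_of_nonneg (sub_nonneg.2 hsj.1)]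
      have hq : (s - t j) / (t (j + 1) - t j) ≤ 1 := by
        rw [div_le_one hpos]; linarith [hsj.2]
      have hd := hγ.dist_le_mul _ (ht01 j hj.le) _ (ht01 (j + 1) hj)
      rw [Real.dist_eq, abs_sub_comm, abs_of_pos hpos] at hd
      calc _ ≤ 1 * dist (γ (t j)) (γ (t (j + 1))) := mul_le_mul_of_nonneg_right hq dist_nonneg
        _ ≤ K * (t (j + 1) - t j) := by rw [one_mul]; exact hd
        _ ≤ K * ε := mul_le_mul_of_nonneg_left (hmesh j hj) hK
    have e2 : dist (γ (t j)) (γ s) ≤ K * ε := by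
      have hd := hγ.dist_le_mul _ (ht01 j hj.le) _ hs
      rw [Real.dist_eq, abs_sub_comm, abs_of_nonneg (sub_nonneg.2 hsj.1)] at hd
      refine hd.trans (mul_le_mul_of_nonneg_left ?_ hK)
      linarith [hmesh j hj, hsj.2]
    linarith [dist_triangle (c s) (γ (t j)) (γ s)]
  · rw [hlen, hsplit γ]
    refine Finset.sum_le_sum fun j hj => ?_
    rw [← edist_dist]
    exact hlow γ j (Finset.mem_range.1 hj)
end

section
/- Let (X,d) be a metric space and endow ℝ × X with the metric dist((s,x),(t,y)) := max{|s−t|, d(x,y)}. For a curve γ : [0,1] → X write gr(γ) := { (t, γ(t)) : t ∈ [0,1] } ⊆ ℝ × X. Then for all 1-Lipschitz curves γ, γ' : [0,1] → X one has d_H(gr(γ), gr(γ')) ≤ sup_{t∈[0,1]} d(γ(t), γ'(t)) ≤ 2·d_H(gr(γ), gr(γ')), where d_H denotes the Hausdorff distance between subsets of ℝ × X. In particular, on the set of 1-Lipschitz curves [0,1] → X, the topology of uniform convergence coincides with the topology induced by the Hausdorff distance between graphs. -/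
/-- Remark 2.2 of the paper.
On `ℝ × X` with the sup metric, for 1-Lipschitz curves `γ, γ' : [0,1] → X`, the Hausdorff
distance between the graphs and the uniform distance are comparable:
`d_H(gr γ, gr γ') ≤ sup_t d(γ t, γ' t) ≤ 2 d_H(gr γ, gr γ')`.  Hence on 1-Lipschitz curves the
uniform topology and the topology of Hausdorff convergence of graphs coincide. -/
theorem hausdorffDist_graphs_comparable_uniform
    {X : Type*} [MetricSpace X]
    (γ γ' : ℝ → X)
    (hγ : LipschitzOnWith 1 γ (Set.Icc 0 1))
    (hγ' : LipschitzOnWith 1 γ' (Set.Icc 0 1)) :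
    Metric.hausdorffDist ((fun t : ℝ => (t, γ t)) '' Set.Icc 0 1)
        ((fun t : ℝ => (t, γ' t)) '' Set.Icc 0 1)
      ≤ (⨆ t : Set.Icc (0:ℝ) 1, dist (γ ↑t) (γ' ↑t)) ∧
    (⨆ t : Set.Icc (0:ℝ) 1, dist (γ ↑t) (γ' ↑t))
      ≤ 2 * Metric.hausdorffDist ((fun t : ℝ => (t, γ t)) '' Set.Icc 0 1)
            ((fun t : ℝ => (t, γ' t)) '' Set.Icc 0 1) := by
  have hne : (Set.Icc (0:ℝ) 1).Nonempty := ⟨0, by simp⟩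
  have hc : ContinuousOn (fun t : ℝ => (t, γ t)) (Set.Icc 0 1) :=
    continuousOn_id.prodMk hγ.continuousOn
  have hc' : ContinuousOn (fun t : ℝ => (t, γ' t)) (Set.Icc 0 1) :=
    continuousOn_id.prodMk hγ'.continuousOn
  have hfin := Metric.hausdorffEDist_ne_top_of_nonempty_of_bounded (hne.image _) (hne.image _)
    (isCompact_Icc.image_of_continuousOn hc).isBounded
    (isCompact_Icc.image_of_continuousOn hc').isBounded
  have hbdd : BddAbove (Set.range fun t : Set.Icc (0:ℝ) 1 => dist (γ ↑t) (γ' ↑t)) := by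
    have h := (isCompact_Icc (a := (0:ℝ)) (b := 1)).bddAbove_image
      (continuous_dist.comp_continuousOn (hγ.continuousOn.prodMk hγ'.continuousOn))
    rwa [Set.image_eq_range] at h
  constructor
  · apply Metric.hausdorffDist_le_of_mem_dist
    · exact Real.iSup_nonneg fun _ => dist_nonneg
    · rintro _ ⟨t, ht, rfl⟩
      refine ⟨_, ⟨t, ht, rfl⟩, ?_⟩
      have h := le_ciSup hbdd ⟨t, ht⟩
      simpa [Prod.dist_eq] using h
    · rintro _ ⟨t, ht, rfl⟩
      refine ⟨_, ⟨t, ht, rfl⟩, ?_⟩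
      have h := le_ciSup hbdd ⟨t, ht⟩
      simpa [Prod.dist_eq, dist_comm] using h
  · have : Nonempty (Set.Icc (0:ℝ) 1) := hne.to_subtype
    apply ciSup_le
    rintro ⟨t, ht⟩
    apply le_of_forall_pos_le_add
    intro ε hε
    obtain ⟨_, ⟨s, hs, rfl⟩, h⟩ := Metric.exists_dist_lt_of_hausdorffDist_lt
      (Set.mem_image_of_mem (fun t : ℝ => (t, γ t)) ht)
      (lt_add_of_pos_right _ (half_pos hε)) hfin
    rw [Prod.dist_eq, max_lt_iff] at h
    obtain ⟨h1, h2⟩ := h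
    have h3 := hγ'.dist_le_mul s hs t ht
    rw [dist_comm s t] at h3
    have h4 := dist_triangle (γ t) (γ' s) (γ' t)
    simp only [NNReal.coe_one, one_mul] at h1 h2 h3 ⊢
    linarith
end

section
/- Let f, π : ℝ² → ℝ be Lipschitz functions. Then ∫_{[0,1]²} ( ∂₁f·∂₂π − ∂₂f·∂₁π ) dℒ² = ∫₀¹ f(t,0)·(d/dt)π(t,0) dt + ∫₀¹ f(1,t)·(d/dt)π(1,t) dt − ∫₀¹ f(t,1)·(d/dt)π(t,1) dt − ∫₀¹ f(0,t)·(d/dt)π(0,t) dt, where ∂₁, ∂₂ denote the partial derivatives of f and π (which exist ℒ²-almost everywhere by Rademacher's theorem) and (d/dt) denotes the derivative of the indicated one-variable Lipschitz slice of π (which exists ℒ¹-almost everywhere); all derivatives may be taken as Mathlib's everywhere-defined fderiv/deriv, which agree with the true derivatives almost everywhere. -/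
open MeasureTheory

section GreenHelpers

open Filter Topology Set

lemma green_slice1 {f : ℝ × ℝ → ℝ} {K : NNReal} (hf : LipschitzWith K f) (y : ℝ) :
    LipschitzWith K (fun s => f (s, y)) := by
  have h := hf.comp (LipschitzWith.prodMk_right y)
  simpa [Function.comp_def] using h

lemma green_slice2 {f : ℝ × ℝ → ℝ} {K : NNReal} (hf : LipschitzWith K f) (x : ℝ) :
    LipschitzWith K (fun s => f (x, s)) := by
  have h := hf.comp (LipschitzWith.prodMk_left x)
  simpa [Function.comp_def] using h

lemma green_d1_line (f : ℝ × ℝ → ℝ) (p : ℝ × ℝ) :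
    deriv (fun s => f (s, p.2)) p.1 = lineDeriv ℝ f p (1, 0) := by
  have h := deriv_comp_const_add (fun s => f (s, p.2)) p.1 0
  rw [add_zero] at h
  rw [← h, lineDeriv]
  congr 1
  ext t
  congr 1
  ext <;> simp

lemma green_d2_line (f : ℝ × ℝ → ℝ) (p : ℝ × ℝ) :
    deriv (fun s => f (p.1, s)) p.2 = lineDeriv ℝ f p (0, 1) := by
  have h := deriv_comp_const_add (fun s => f (p.1, s)) p.2 0
  rw [add_zero] at h
  rw [← h, lineDeriv]
  congr 1
  ext t
  congr 1
  ext <;> simp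

lemma green_meas1 {f : ℝ × ℝ → ℝ} (hf : Continuous f) :
    Measurable (fun p : ℝ × ℝ => deriv (fun s => f (s, p.2)) p.1) := by
  simp_rw [green_d1_line]
  exact measurable_lineDeriv hf

lemma green_meas2 {f : ℝ × ℝ → ℝ} (hf : Continuous f) :
    Measurable (fun p : ℝ × ℝ => deriv (fun s => f (p.1, s)) p.2) := by
  simp_rw [green_d2_line]
  exact measurable_lineDeriv hf

lemma green_ae1 {f : ℝ × ℝ → ℝ} {K : NNReal} (hf : LipschitzWith K f) :
    ∀ᵐ p : ℝ × ℝ, DifferentiableAt ℝ (fun s => f (s, p.2)) p.1 := by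
  filter_upwards [hf.ae_lineDifferentiableAt (μ := volume) ((1 : ℝ), (0 : ℝ))] with p hp
  have h1 : DifferentiableAt ℝ (fun t : ℝ => f (p + t • ((1 : ℝ), (0 : ℝ)))) (p.1 - p.1) := by
    rw [sub_self]; exact hp
  have h2 := h1.comp p.1 (f := fun s : ℝ => s - p.1) (by fun_prop)
  have e : (fun s => f (s, p.2)) =
      (fun t : ℝ => f (p + t • ((1 : ℝ), (0 : ℝ)))) ∘ fun s : ℝ => s - p.1 := by
    ext s
    rw [Function.comp_apply]
    congr 1
    ext <;> simp
  rw [e]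
  exact h2

lemma green_abs_quot {v : ℝ → ℝ} {K : NNReal} (hv : LipschitzWith K v) (x h : ℝ) (hh : h ≠ 0) :
    ‖h⁻¹ * (v (x + h) - v x)‖ ≤ K := by
  have h1 := hv.norm_sub_le (x + h) x
  rw [add_sub_cancel_left] at h1
  rw [norm_mul, norm_inv]
  have : 0 < ‖h‖ := norm_pos_iff.2 hh
  rw [inv_mul_le_iff₀ this, mul_comm]
  exact h1

lemma green_T2 {u v : ℝ × ℝ → ℝ} {K : NNReal} {C : ℝ} (hu : Measurable u) (hC : ∀ p, ‖u p‖ ≤ C)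
    (hv : LipschitzWith K v) :
    Tendsto (fun h : ℝ => ∫ p in (Icc (0:ℝ) 1 ×ˢ Icc (0:ℝ) 1),
        u p * (h⁻¹ * (v (p.1 + h, p.2) - v (p.1, p.2)))) (𝓝[≠] 0)
      (𝓝 (∫ p in (Icc (0:ℝ) 1 ×ˢ Icc (0:ℝ) 1), u p * deriv (fun s => v (s, p.2)) p.1)) := by
  have hvm : Measurable v := hv.continuous.measurable
  apply tendsto_integral_filter_of_dominated_convergence (fun _ => C * K)
  · filter_upwards with h
    apply Measurable.aestronglyMeasurable
    fun_prop
  · filter_upwards [self_mem_nhdsWithin] with h hh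
    filter_upwards with p
    rw [norm_mul]
    have h0 : 0 ≤ C := (norm_nonneg _).trans (hC p)
    exact mul_le_mul (hC p) (green_abs_quot (green_slice1 hv p.2) p.1 h hh) (norm_nonneg _) h0
  · have : IsFiniteMeasure (volume.restrict (Icc (0:ℝ) 1 ×ˢ Icc (0:ℝ) 1)) :=
      ⟨by rw [Measure.restrict_apply_univ]
          exact (isCompact_Icc.prod isCompact_Icc).measure_lt_top⟩
    exact integrable_const _
  · filter_upwards [ae_restrict_of_ae (green_ae1 hv)] with p hp
    exact (hp.hasDerivAt.tendsto_slope_zero).const_mul (u p)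

lemma green_T1 {u v : ℝ → ℝ} {K : NNReal} (hu : Continuous u) (hv : LipschitzWith K v) :
    Tendsto (fun h : ℝ => ∫ t in (0:ℝ)..1, u t * (h⁻¹ * (v (t + h) - v t))) (𝓝[≠] 0)
      (𝓝 (∫ t in (0:ℝ)..1, u t * deriv v t)) := by
  have hvm : Measurable v := hv.continuous.measurable
  have hum := hu.measurable
  apply intervalIntegral.tendsto_integral_filter_of_dominated_convergence (fun t => ‖u t‖ * K)
  · filter_upwards with h
    apply Measurable.aestronglyMeasurable
    fun_prop
  · filter_upwards [self_mem_nhdsWithin] with h hh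
    filter_upwards with p _
    rw [norm_mul]
    exact mul_le_mul_of_nonneg_left (green_abs_quot hv p h hh) (norm_nonneg _)
  · exact Continuous.intervalIntegrable (by fun_prop) _ _
  · filter_upwards [hv.ae_differentiableAt_real] with p hp _
    exact (hp.hasDerivAt.tendsto_slope_zero).const_mul (u p)

lemma green_ac {v : ℝ → ℝ} {K : NNReal} (hv : LipschitzWith K v) (a b : ℝ) :
    AbsolutelyContinuousOnInterval v a b :=
  (hv.lipschitzOnWith).absolutelyContinuousOnInterval

/-- One-variable identity from integration by parts. -/
lemma green_ibp {a b p q : ℝ → ℝ} {K L M N : NNReal} (ha : LipschitzWith K a)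
    (hb : LipschitzWith L b) (hp : LipschitzWith M p) (hq : LipschitzWith N q) :
    (∫ y in (0:ℝ)..1, b y * deriv q y) - (∫ y in (0:ℝ)..1, a y * deriv p y)
      = (∫ y in (0:ℝ)..1, deriv q y * (b y - a y)) - (∫ y in (0:ℝ)..1, deriv a y * (q y - p y))
        + a 1 * (q 1 - p 1) - a 0 * (q 0 - p 0) := by
  have ip := (green_ac hp 0 1).intervalIntegrable_deriv
  have iq := (green_ac hq 0 1).intervalIntegrable_deriv
  have ia := (green_ac ha 0 1).intervalIntegrable_deriv
  have e1 := (green_ac ha 0 1).integral_mul_deriv_eq_deriv_mul (green_ac hp 0 1)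
  have e2 := (green_ac ha 0 1).integral_mul_deriv_eq_deriv_mul (green_ac hq 0 1)
  have e3 : (∫ y in (0:ℝ)..1, deriv q y * (b y - a y))
      = (∫ y in (0:ℝ)..1, b y * deriv q y) - (∫ y in (0:ℝ)..1, a y * deriv q y) := by
    rw [← intervalIntegral.integral_sub]
    · congr 1; ext y; ring
    · exact iq.continuousOn_mul hb.continuous.continuousOn
    · exact iq.continuousOn_mul ha.continuous.continuousOn
  have e4 : (∫ y in (0:ℝ)..1, deriv a y * (q y - p y))
      = (∫ y in (0:ℝ)..1, deriv a y * q y) - (∫ y in (0:ℝ)..1, deriv a y * p y) := by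
    rw [← intervalIntegral.integral_sub]
    · congr 1; ext y; ring
    · exact ia.mul_continuousOn hq.continuous.continuousOn
    · exact ia.mul_continuousOn hp.continuous.continuousOn
  rw [e3, e4]
  linarith

lemma green_inner_meas {F : ℝ × ℝ → ℝ} (hF : Measurable F) :
    StronglyMeasurable (fun x => ∫ y in (0:ℝ)..1, F (x, y)) := by
  simp_rw [intervalIntegral.integral_of_le zero_le_one]
  exact hF.stronglyMeasurable.integral_prod_right'

lemma green_inner_bound {F : ℝ × ℝ → ℝ} {C : ℝ} (hC : ∀ p, ‖F p‖ ≤ C) (x : ℝ) :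
    ‖∫ y in (0:ℝ)..1, F (x, y)‖ ≤ C := by
  have := intervalIntegral.norm_integral_le_of_norm_le_const (a := (0:ℝ)) (b := 1)
    (f := fun y => F (x, y)) (C := C) (fun y _ => hC _)
  simpa using this

lemma green_ii {G : ℝ → ℝ} {C : ℝ} (hG : StronglyMeasurable G) (hC : ∀ x, ‖G x‖ ≤ C) (a b : ℝ) :
    IntervalIntegrable G volume a b := by
  refine (intervalIntegrable_const (c := C)).mono_fun hG.aestronglyMeasurable ?_
  filter_upwards with x
  exact (hC x).trans (le_abs_self C)

lemma green_integrableQ {F : ℝ × ℝ → ℝ} {C : ℝ} (hF : Measurable F) (hC : ∀ p, ‖F p‖ ≤ C) :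
    IntegrableOn F (Icc (0:ℝ) 1 ×ˢ Icc (0:ℝ) 1) :=
  Measure.integrableOn_of_bounded (isCompact_Icc.prod isCompact_Icc).measure_lt_top.ne
    hF.aestronglyMeasurable (ae_of_all _ hC)

lemma green_fubini {F : ℝ × ℝ → ℝ} {C : ℝ} (hF : Measurable F) (hC : ∀ p, ‖F p‖ ≤ C) :
    ∫ p in (Icc (0:ℝ) 1 ×ˢ Icc (0:ℝ) 1), F p = ∫ x in (0:ℝ)..1, ∫ y in (0:ℝ)..1, F (x, y) := by
  simp_rw [intervalIntegral.integral_of_le zero_le_one, ← integral_Icc_eq_integral_Ioc]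
  exact setIntegral_prod _ (green_integrableQ hF hC)

/-- Shifting the interval of integration costs little. -/
lemma green_shift {G : ℝ → ℝ} {C : ℝ} (hG : StronglyMeasurable G) (hC : ∀ x, ‖G x‖ ≤ C) (h : ℝ) :
    ‖(∫ x in (0:ℝ)..1, G (x + h)) - ∫ x in (0:ℝ)..1, G x‖ ≤ 2 * C * |h| := by
  rw [intervalIntegral.integral_comp_add_right,
    intervalIntegral.integral_interval_sub_interval_comm' (green_ii hG hC _ _) (green_ii hG hC _ _)
      (green_ii hG hC _ _)]
  have h1 := intervalIntegral.norm_integral_le_of_norm_le_const (a := (1:ℝ)) (b := 1 + h)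
    (f := G) (C := C) (fun y _ => hC _)
  have h2 := intervalIntegral.norm_integral_le_of_norm_le_const (a := (0:ℝ)) (b := 0 + h)
    (f := G) (C := C) (fun y _ => hC _)
  rw [add_sub_cancel_left] at h1 h2
  calc _ ≤ _ := norm_sub_le _ _
    _ ≤ _ := by linarith

lemma green_slope {g : ℝ → ℝ} (hg : Continuous g) :
    Tendsto (fun h : ℝ => h⁻¹ * ∫ x in (0:ℝ)..1, (g (x + h) - g x)) (𝓝[≠] 0)
      (𝓝 (g 1 - g 0)) := by
  have H : ∀ b, HasDerivAt (fun u => ∫ x in (0:ℝ)..u, g x) (g b) b := fun b =>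
    intervalIntegral.integral_hasDerivAt_right (hg.intervalIntegrable _ _)
      hg.aestronglyMeasurable.stronglyMeasurableAtFilter hg.continuousAt
  have := (H 1).tendsto_slope_zero.sub (H 0).tendsto_slope_zero
  refine this.congr fun h => ?_
  have i : ∀ a b, IntervalIntegrable g volume a b := fun a b => hg.intervalIntegrable a b
  rw [intervalIntegral.integral_sub (Continuous.intervalIntegrable (by fun_prop) _ _) (i _ _),
    intervalIntegral.integral_comp_add_right,
    intervalIntegral.integral_interval_sub_interval_comm' (i (0 + h) (1 + h)) (i 0 1) (i _ _)]
  have e := intervalIntegral.integral_interval_sub_left (i 0 (1 + h)) (i 0 1)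
  rw [e]
  simp [mul_sub]

end GreenHelpers

/-- boundary of the current `e₁∧e₂⟦[0,1]²⟧`, Section 4 of the paper.
For Lipschitz `f, π : ℝ² → ℝ`,
`∫_{[0,1]²} (∂₁f·∂₂π − ∂₂f·∂₁π) dℒ²
  = ∫₀¹ f(t,0) ∂ₜπ(t,0) dt + ∫₀¹ f(1,t) ∂ₜπ(1,t) dt
    − ∫₀¹ f(t,1) ∂ₜπ(t,1) dt − ∫₀¹ f(0,t) ∂ₜπ(0,t) dt`,
where the (a.e.-defined) partial derivatives are expressed via Mathlib's total `deriv` of the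
one-variable slices. -/
theorem green_identity_unit_square
    (f π : ℝ × ℝ → ℝ) (Kf Kπ : NNReal)
    (hf : LipschitzWith Kf f) (hπ : LipschitzWith Kπ π) :
    (∫ p in (Set.Icc (0:ℝ) 1 ×ˢ Set.Icc (0:ℝ) 1),
        (deriv (fun s => f (s, p.2)) p.1 * deriv (fun s => π (p.1, s)) p.2
          - deriv (fun s => f (p.1, s)) p.2 * deriv (fun s => π (s, p.2)) p.1))
      = (∫ t in (0:ℝ)..1, f (t, 0) * deriv (fun s => π (s, 0)) t)
        + (∫ t in (0:ℝ)..1, f (1, t) * deriv (fun s => π (1, s)) t)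
        - (∫ t in (0:ℝ)..1, f (t, 1) * deriv (fun s => π (s, 1)) t)
        - (∫ t in (0:ℝ)..1, f (0, t) * deriv (fun s => π (0, s)) t) := by
  set Q : Set (ℝ × ℝ) := Set.Icc (0:ℝ) 1 ×ˢ Set.Icc (0:ℝ) 1 with hQ
  have hf1 := green_slice1 hf
  have hf2 := green_slice2 hf
  have hπ1 := green_slice1 hπ
  have hπ2 := green_slice2 hπ
  have mf := hf.continuous.measurable
  have mπ := hπ.continuous.measurable
  have mf1 := green_meas1 hf.continuous
  have mf2 := green_meas2 hf.continuous
  have mπ1 := green_meas1 hπ.continuous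
  have mπ2 := green_meas2 hπ.continuous
  have bf1 : ∀ p : ℝ × ℝ, ‖deriv (fun s => f (s, p.2)) p.1‖ ≤ Kf := fun p =>
    norm_deriv_le_of_lipschitz (hf1 p.2)
  have bf2 : ∀ p : ℝ × ℝ, ‖deriv (fun s => f (p.1, s)) p.2‖ ≤ Kf := fun p =>
    norm_deriv_le_of_lipschitz (hf2 p.1)
  have bπ1 : ∀ p : ℝ × ℝ, ‖deriv (fun s => π (s, p.2)) p.1‖ ≤ Kπ := fun p =>
    norm_deriv_le_of_lipschitz (hπ1 p.2)
  have bπ2 : ∀ p : ℝ × ℝ, ‖deriv (fun s => π (p.1, s)) p.2‖ ≤ Kπ := fun p =>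
    norm_deriv_le_of_lipschitz (hπ2 p.1)
  have bmul : ∀ {a b : ℝ} {A B : NNReal}, ‖a‖ ≤ A → ‖b‖ ≤ B → ‖a * b‖ ≤ (A : ℝ) * B := by
    intro a b A B h1 h2
    rw [norm_mul]
    exact mul_le_mul h1 h2 (norm_nonneg _) A.2
  set g : ℝ → ℝ := fun x => ∫ y in (0:ℝ)..1, f (x, y) * deriv (fun s => π (x, s)) y with hg
  have key : ∀ x x', g x' - g x =
      (∫ y in (0:ℝ)..1, deriv (fun s => π (x', s)) y * (f (x', y) - f (x, y)))
        - (∫ y in (0:ℝ)..1, deriv (fun s => f (x, s)) y * (π (x', y) - π (x, y)))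
        + f (x, 1) * (π (x', 1) - π (x, 1)) - f (x, 0) * (π (x', 0) - π (x, 0)) := fun x x' =>
    green_ibp (hf2 x) (hf2 x') (hπ2 x) (hπ2 x')
  have gcont : Continuous g := by
    rw [continuous_iff_continuousAt]
    intro x
    rw [ContinuousAt, tendsto_iff_norm_sub_tendsto_zero]
    have lim : Filter.Tendsto
        (fun x' => (Kπ * Kf + Kf * Kπ + ‖f (x, 1)‖ * Kπ + ‖f (x, 0)‖ * Kπ) * ‖x' - x‖)
        (nhds x) (nhds 0) := by
      have : Continuous (fun x' : ℝ =>
        ((Kπ:ℝ) * Kf + Kf * Kπ + ‖f (x, 1)‖ * Kπ + ‖f (x, 0)‖ * Kπ) * ‖x' - x‖) := by fun_prop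
      have := this.tendsto x
      simpa using this
    refine squeeze_zero (fun _ => norm_nonneg _) (fun x' => ?_) lim
    rw [key x x']
    have b1 : ‖∫ y in (0:ℝ)..1, deriv (fun s => π (x', s)) y * (f (x', y) - f (x, y))‖
        ≤ Kπ * (Kf * ‖x' - x‖) := by
      have := intervalIntegral.norm_integral_le_of_norm_le_const (a := (0:ℝ)) (b := 1)
        (f := fun y => deriv (fun s => π (x', s)) y * (f (x', y) - f (x, y)))
        (C := Kπ * (Kf * ‖x' - x‖)) (fun y _ => by
          rw [norm_mul]
          exact mul_le_mul (bπ2 (x', y)) ((hf1 y).norm_sub_le x' x) (norm_nonneg _) Kπ.2)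
      simpa using this
    have b2 : ‖∫ y in (0:ℝ)..1, deriv (fun s => f (x, s)) y * (π (x', y) - π (x, y))‖
        ≤ Kf * (Kπ * ‖x' - x‖) := by
      have := intervalIntegral.norm_integral_le_of_norm_le_const (a := (0:ℝ)) (b := 1)
        (f := fun y => deriv (fun s => f (x, s)) y * (π (x', y) - π (x, y)))
        (C := Kf * (Kπ * ‖x' - x‖)) (fun y _ => by
          rw [norm_mul]
          exact mul_le_mul (bf2 (x, y)) ((hπ1 y).norm_sub_le x' x) (norm_nonneg _) Kf.2)
      simpa using this
    have b3 : ∀ c, ‖f (x, c) * (π (x', c) - π (x, c))‖ ≤ ‖f (x, c)‖ * (Kπ * ‖x' - x‖) := by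
      intro c
      rw [norm_mul]
      exact mul_le_mul_of_nonneg_left ((hπ1 c).norm_sub_le x' x) (norm_nonneg _)
    refine (norm_sub_le _ _).trans ?_
    refine (add_le_add ((norm_add_le _ _).trans (add_le_add (norm_sub_le _ _) le_rfl)) le_rfl).trans ?_
    have := b3 0
    have := b3 1
    linarith
  -- the difference quotients
  have ident : ∀ h : ℝ, h ≠ 0 → h⁻¹ * (∫ x in (0:ℝ)..1, (g (x + h) - g x))
      = (∫ x in (0:ℝ)..1, ∫ y in (0:ℝ)..1, deriv (fun s => π (x + h, s)) y *
            ((-h)⁻¹ * (f (x + h + -h, y) - f (x + h, y))))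
        - (∫ p in Q, deriv (fun s => f (p.1, s)) p.2 * (h⁻¹ * (π (p.1 + h, p.2) - π (p.1, p.2))))
        + (∫ x in (0:ℝ)..1, f (x, 1) * (h⁻¹ * (π (x + h, 1) - π (x, 1))))
        - (∫ x in (0:ℝ)..1, f (x, 0) * (h⁻¹ * (π (x + h, 0) - π (x, 0)))) := by
    intro h hh
    have mA : Measurable (fun p : ℝ × ℝ => deriv (fun s => π (p.1 + h, s)) p.2 *
            ((-h)⁻¹ * (f (p.1 + h + -h, p.2) - f (p.1 + h, p.2)))) := by
      have : Measurable (fun p : ℝ × ℝ => deriv (fun s => π (p.1 + h, s)) p.2) :=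
        mπ2.comp (g := fun p : ℝ × ℝ => deriv (fun s => π (p.1, s)) p.2)
          (f := fun p : ℝ × ℝ => (p.1 + h, p.2)) (by fun_prop)
      fun_prop
    have mB : Measurable (fun p : ℝ × ℝ => deriv (fun s => f (p.1, s)) p.2 *
        (h⁻¹ * (π (p.1 + h, p.2) - π (p.1, p.2)))) := by fun_prop
    have bA : ∀ p : ℝ × ℝ, ‖deriv (fun s => π (p.1 + h, s)) p.2 *
            ((-h)⁻¹ * (f (p.1 + h + -h, p.2) - f (p.1 + h, p.2)))‖ ≤ (Kπ : ℝ) * Kf := fun p =>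
      bmul (bπ2 (p.1 + h, p.2)) (green_abs_quot (hf1 p.2) (p.1 + h) (-h) (neg_ne_zero.2 hh))
    have bB : ∀ p : ℝ × ℝ, ‖deriv (fun s => f (p.1, s)) p.2 *
        (h⁻¹ * (π (p.1 + h, p.2) - π (p.1, p.2)))‖ ≤ (Kf : ℝ) * Kπ := fun p =>
      bmul (bf2 p) (green_abs_quot (hπ1 p.2) p.1 h hh)
    have iA := green_ii (green_inner_meas mA) (green_inner_bound bA) 0 1
    have iB := green_ii (green_inner_meas mB) (green_inner_bound bB) 0 1
    have cf := hf.continuous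
    have cπ := hπ.continuous
    have iC : ∀ c, IntervalIntegrable (fun x => f (x, c) * (h⁻¹ * (π (x + h, c) - π (x, c))))
        volume 0 1 := fun c => Continuous.intervalIntegrable (by fun_prop) _ _
    rw [green_fubini mB bB, ← intervalIntegral.integral_sub iA iB,
      ← intervalIntegral.integral_add (iA.sub iB) (iC 1),
      ← intervalIntegral.integral_sub ((iA.sub iB).add (iC 1)) (iC 0),
      ← intervalIntegral.integral_const_mul]
    apply intervalIntegral.integral_congr
    intro x _
    simp only
    rw [key x (x + h)]
    have e1 : (∫ y in (0:ℝ)..1, deriv (fun s => π (x + h, s)) y *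
            ((-h)⁻¹ * (f (x + h + -h, y) - f (x + h, y))))
        = h⁻¹ * ∫ y in (0:ℝ)..1, deriv (fun s => π (x + h, s)) y * (f (x + h, y) - f (x, y)) := by
      rw [← intervalIntegral.integral_const_mul]
      congr 1
      ext y
      rw [add_neg_cancel_right, inv_neg]
      ring
    have e2 : (∫ y in (0:ℝ)..1, deriv (fun s => f (x, s)) y *
        (h⁻¹ * (π (x + h, y) - π (x, y))))
        = h⁻¹ * ∫ y in (0:ℝ)..1, deriv (fun s => f (x, s)) y * (π (x + h, y) - π (x, y)) := by
      rw [← intervalIntegral.integral_const_mul]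
      congr 1
      ext y
      ring
    rw [e1, e2]
    ring
  have negT : Filter.Tendsto (fun h : ℝ => -h) (nhdsWithin 0 {0}ᶜ) (nhdsWithin 0 {0}ᶜ) := by
    apply tendsto_nhdsWithin_of_tendsto_nhds_of_eventually_within
    · have := (continuous_neg (G := ℝ)).tendsto 0
      rw [neg_zero] at this
      exact this.mono_left nhdsWithin_le_nhds
    · filter_upwards [self_mem_nhdsWithin] with h hh
      exact neg_ne_zero.2 hh
  have L1 : Filter.Tendsto (fun h : ℝ => ∫ x in (0:ℝ)..1, ∫ y in (0:ℝ)..1,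
        deriv (fun s => π (x + h, s)) y * ((-h)⁻¹ * (f (x + h + -h, y) - f (x + h, y))))
      (nhdsWithin 0 {0}ᶜ)
      (nhds (∫ p in Q, deriv (fun s => π (p.1, s)) p.2 * deriv (fun s => f (s, p.2)) p.1)) := by
    have base := (green_T2 mπ2 bπ2 hf).comp negT
    have small : Filter.Tendsto (fun h : ℝ => 2 * ((Kπ : ℝ) * Kf) * |h|)
        (nhdsWithin 0 {0}ᶜ) (nhds 0) := by
      have : Continuous (fun h : ℝ => 2 * ((Kπ : ℝ) * Kf) * |h|) := by fun_prop
      have := this.tendsto 0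
      simp only [abs_zero, mul_zero] at this
      exact this.mono_left nhdsWithin_le_nhds
    refine tendsto_of_tendsto_of_dist base (squeeze_zero' (Filter.Eventually.of_forall
      fun _ => dist_nonneg) ?_ small)
    filter_upwards [self_mem_nhdsWithin] with h hh
    have mA : Measurable (fun p : ℝ × ℝ => deriv (fun s => π (p.1, s)) p.2 *
            ((-h)⁻¹ * (f (p.1 + -h, p.2) - f (p.1, p.2)))) := by fun_prop
    have bA : ∀ p : ℝ × ℝ, ‖deriv (fun s => π (p.1, s)) p.2 *
            ((-h)⁻¹ * (f (p.1 + -h, p.2) - f (p.1, p.2)))‖ ≤ (Kπ : ℝ) * Kf := fun p =>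
      bmul (bπ2 p) (green_abs_quot (hf1 p.2) p.1 (-h) (neg_ne_zero.2 hh))
    have := green_shift (green_inner_meas mA) (green_inner_bound bA) h
    rw [dist_comm, dist_eq_norm, Function.comp_apply, green_fubini mA bA]
    exact this
  have L2 := green_T2 mf2 bf2 hπ
  have cf := hf.continuous
  have L3 := green_T1 (u := fun x => f (x, 1)) (by fun_prop) (hπ1 1)
  have L4 := green_T1 (u := fun x => f (x, 0)) (by fun_prop) (hπ1 0)
  have LL := ((L1.sub L2).add L3).sub L4
  have LR := green_slope gcont
  have E := tendsto_nhds_unique (LR.congr' (by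
    filter_upwards [self_mem_nhdsWithin] with h hh
    exact ident h hh)) LL
  have split : (∫ p in Q, (deriv (fun s => f (s, p.2)) p.1 * deriv (fun s => π (p.1, s)) p.2
          - deriv (fun s => f (p.1, s)) p.2 * deriv (fun s => π (s, p.2)) p.1))
      = (∫ p in Q, deriv (fun s => π (p.1, s)) p.2 * deriv (fun s => f (s, p.2)) p.1)
        - ∫ p in Q, deriv (fun s => f (p.1, s)) p.2 * deriv (fun s => π (s, p.2)) p.1 := by
    refine Eq.trans ?_ (integral_sub (green_integrableQ (mπ2.mul mf1) (fun p => bmul (bπ2 p) (bf1 p)))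
      (green_integrableQ (mf2.mul mπ1) (fun p => bmul (bf2 p) (bπ1 p))))
    congr 1
    ext p
    ring
  rw [split]
  simp only [hg] at E
  linarith
end

section
/- Let (X,d) be a complete and separable metric space. Define the curve-fragment space Frag(X) := { G : G is a nonempty compact subset of ℝ × X, G ⊆ [0,1] × X, and d(x,y) ≤ |s−t| for all (s,x), (t,y) ∈ G }, equipped with the Hausdorff metric inherited from the space of nonempty compact subsets of ℝ × X (where ℝ × X carries the metric max{|s−t|, d(x,y)}); elements of Frag(X) are exactly the graphs of 1-Lipschitz maps γ : K → X with K ⊆ [0,1] compact nonempty. Let E ⊆ X be a nonempty σ-compact set and F := closure(E). Then: (a) the set A := { G ∈ Frag(X) : G ∩ (ℝ × E) ≠ ∅ } is a Borel subset of Frag(X); (b) the map Φ : A → Frag(X) defined by Φ(G) := closure( G ∩ (ℝ × E) ) is well defined (i.e. Φ(G) ∈ Frag(X)) and Borel measurable; and (c) G ∩ (ℝ × E) ⊆ Φ(G) ⊆ G ∩ (ℝ × F) for every G ∈ A. -/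
open Filter Topology TopologicalSpace MeasureTheory

/-- The space of curve fragments of `X`, realised as the space of nonempty compact subsets
`G ⊆ [0,1] × X` of `ℝ × X` (with the sup metric) satisfying `d(x,y) ≤ |s−t|` for all
`(s,x), (t,y) ∈ G`; such `G` are exactly the graphs of 1-Lipschitz maps `γ : K → X` with
`K ⊆ [0,1]` compact nonempty.  `Frag X` carries the Hausdorff metric of
`NonemptyCompacts (ℝ × X)`. -/
def Frag (X : Type*) [MetricSpace X] : Type _ :=
  { G : NonemptyCompacts (ℝ × X) //
      (∀ p ∈ (G : Set (ℝ × X)), p.1 ∈ Set.Icc (0:ℝ) 1) ∧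
      (∀ p ∈ (G : Set (ℝ × X)), ∀ q ∈ (G : Set (ℝ × X)), dist p.2 q.2 ≤ |p.1 - q.1|) }

noncomputable instance (X : Type*) [MetricSpace X] : MetricSpace (Frag X) := by
  unfold Frag; infer_instance

open Set in
theorem Frag.isInducing_val (X : Type*) [MetricSpace X] :
    IsInducing (fun G : Frag X => (G.1 : NonemptyCompacts (ℝ × X))) :=
  ⟨rfl⟩

open Set in
theorem Frag.measurableSet_hit {X : Type*} [MetricSpace X] (S : Set (ℝ × X))
    (C : ℕ → Set (ℝ × X)) (hC : ∀ n, IsClosed (C n)) (hS : ⋃ n, C n = S) (U : Set (ℝ × X))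
    (hU : IsOpen U) :
    MeasurableSet[borel (Frag X)] {G : Frag X | (((G.1 : Set (ℝ × X)) ∩ S) ∩ U).Nonempty} := by
  letI : MeasurableSpace (Frag X) := borel (Frag X)
  haveI : BorelSpace (Frag X) := ⟨rfl⟩
  obtain ⟨D, hD, -, hDU, -⟩ := hU.exists_iUnion_isClosed
  have h : {G : Frag X | (((G.1 : Set (ℝ × X)) ∩ S) ∩ U).Nonempty}
      = ⋃ n, ⋃ m, {G : Frag X | ((G.1 : Set (ℝ × X)) ∩ (C n ∩ D m)).Nonempty} := by
    ext G
    simp only [mem_setOf_eq, mem_iUnion, ← hS, ← hDU]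
    constructor
    · rintro ⟨p, ⟨hp, hpC⟩, hpD⟩
      obtain ⟨n, hn⟩ := mem_iUnion.1 hpC
      obtain ⟨m, hm⟩ := mem_iUnion.1 hpD
      exact ⟨n, m, p, hp, hn, hm⟩
    · rintro ⟨n, m, p, hp, hn, hm⟩
      exact ⟨p, ⟨hp, mem_iUnion.2 ⟨n, hn⟩⟩, mem_iUnion.2 ⟨m, hm⟩⟩
  rw [h]
  refine MeasurableSet.iUnion fun n => MeasurableSet.iUnion fun m => IsClosed.measurableSet ?_
  exact (NonemptyCompacts.isClosed_inter_nonempty_of_isClosed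
    ((hC n).inter (hD m))).preimage (Frag.isInducing_val X).continuous

open Set in
theorem Frag.borel_eq (X : Type*) [MetricSpace X] [SeparableSpace X] :
    borel (Frag X) = MeasurableSpace.generateFrom
      ({A | ∃ U : Set (ℝ × X), IsOpen U ∧ A = {G : Frag X | (G.1 : Set (ℝ × X)) ⊆ U}} ∪
       {A | ∃ U : Set (ℝ × X), IsOpen U ∧
          A = {G : Frag X | ((G.1 : Set (ℝ × X)) ∩ U).Nonempty}}) := by
  haveI : SecondCountableTopology X := UniformSpace.secondCountable_of_separable X
  haveI : SecondCountableTopology (Frag X) := (Frag.isInducing_val X).secondCountableTopology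
  refine borel_eq_generateFrom_of_subbasis ?_
  rw [(Frag.isInducing_val X).eq_induced]
  have h1 : (NonemptyCompacts.topology : TopologicalSpace (NonemptyCompacts (ℝ × X))) =
      TopologicalSpace.induced (↑) (TopologicalSpace.vietoris (ℝ × X)) := rfl
  change TopologicalSpace.induced _ (NonemptyCompacts.topology) = _
  rw [h1, TopologicalSpace.vietoris, induced_generateFrom_eq, induced_generateFrom_eq]
  congr 1
  ext A
  constructor
  · rintro ⟨_, ⟨_, (⟨U, hU, rfl⟩ | ⟨U, hU, rfl⟩), rfl⟩, rfl⟩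
    · exact Or.inl ⟨U, hU, rfl⟩
    · exact Or.inr ⟨U, hU, rfl⟩
  · rintro (⟨U, hU, rfl⟩ | ⟨U, hU, rfl⟩)
    · exact ⟨_, ⟨_, Or.inl ⟨U, hU, rfl⟩, rfl⟩, rfl⟩
    · exact ⟨_, ⟨_, Or.inr ⟨U, hU, rfl⟩, rfl⟩, rfl⟩

/-- Lemma 2.1 of the paper.
Let `X` be complete and separable, `E ⊆ X` a nonempty σ-compact set and `F := closure E`.
Then (a) the set `A` of fragments meeting `ℝ × E` is Borel in `Frag X`; (b) the map
`Φ(G) := closure (G ∩ (ℝ × E))` takes values in `Frag X` and is Borel measurable on `A`; and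
(c) `G ∩ (ℝ × E) ⊆ Φ(G) ⊆ G ∩ (ℝ × F)` for every `G ∈ A`. -/
theorem frag_restriction_borel
    {X : Type*} [MetricSpace X] [CompleteSpace X] [SeparableSpace X]
    (E : Set X) (hEne : E.Nonempty) (hEσ : IsSigmaCompact E) :
    MeasurableSet[borel (Frag X)]
      {G : Frag X | ((G.1 : Set (ℝ × X)) ∩ {p : ℝ × X | p.2 ∈ E}).Nonempty} ∧
    ∃ Φ : {G : Frag X // ((G.1 : Set (ℝ × X)) ∩ {p : ℝ × X | p.2 ∈ E}).Nonempty} → Frag X,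
      (∀ G, ((Φ G).1 : Set (ℝ × X))
          = closure ((G.1.1 : Set (ℝ × X)) ∩ {p : ℝ × X | p.2 ∈ E})) ∧
      @Measurable _ _ (MeasurableSpace.comap Subtype.val (borel (Frag X)))
        (borel (Frag X)) Φ ∧
      (∀ G, (G.1.1 : Set (ℝ × X)) ∩ {p : ℝ × X | p.2 ∈ E} ⊆ ((Φ G).1 : Set (ℝ × X)) ∧
        ((Φ G).1 : Set (ℝ × X))
          ⊆ (G.1.1 : Set (ℝ × X)) ∩ {p : ℝ × X | p.2 ∈ closure E}) := by
  have hcl : ∀ G : Frag X, closure ((G.1 : Set (ℝ × X)) ∩ {p : ℝ × X | p.2 ∈ E})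
      ⊆ (G.1 : Set (ℝ × X)) := fun G =>
    closure_minimal Set.inter_subset_left G.1.isCompact.isClosed
  obtain ⟨K, hK, hKE⟩ := hEσ
  have hhit : ∀ U : Set (ℝ × X), IsOpen U → MeasurableSet[borel (Frag X)]
      {G : Frag X | (((G.1 : Set (ℝ × X)) ∩ {p : ℝ × X | p.2 ∈ E}) ∩ U).Nonempty} := by
    refine Frag.measurableSet_hit _ (fun n => Prod.snd ⁻¹' K n)
      (fun n => (hK n).isClosed.preimage continuous_snd) ?_
    rw [← Set.preimage_iUnion, hKE]; rfl
  refine ⟨by simpa using hhit Set.univ isOpen_univ, ?_⟩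
  let Φ : {G : Frag X // ((G.1 : Set (ℝ × X)) ∩ {p : ℝ × X | p.2 ∈ E}).Nonempty} → Frag X :=
    fun G => ⟨⟨⟨closure ((G.1.1 : Set (ℝ × X)) ∩ {p : ℝ × X | p.2 ∈ E}),
      G.1.1.isCompact.of_isClosed_subset isClosed_closure (hcl G.1)⟩, G.2.closure⟩,
      fun p hp => G.1.2.1 p (hcl G.1 hp),
      fun p hp q hq => G.1.2.2 p (hcl G.1 hp) q (hcl G.1 hq)⟩
  have hΦ : ∀ G, ((Φ G).1 : Set (ℝ × X))
      = closure ((G.1.1 : Set (ℝ × X)) ∩ {p : ℝ × X | p.2 ∈ E}) := fun G => rfl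
  refine ⟨Φ, hΦ, ?_, fun G => ⟨subset_closure, fun p hp => ⟨hcl G.1 hp, ?_⟩⟩⟩
  · letI : MeasurableSpace (Frag X) := borel (Frag X)
    have hmeet : ∀ U : Set (ℝ × X), IsOpen U →
        MeasurableSet {G | (((Φ G).1 : Set (ℝ × X)) ∩ U).Nonempty} := by
      intro U hU
      refine ⟨_, hhit U hU, ?_⟩
      ext G
      simp only [Set.mem_preimage, Set.mem_setOf_eq, hΦ]
      rw [closure_inter_open_nonempty_iff hU]
    have key : ∀ A ∈ ({A | ∃ U : Set (ℝ × X), IsOpen U ∧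
          A = {G : Frag X | (G.1 : Set (ℝ × X)) ⊆ U}} ∪
        {A | ∃ U : Set (ℝ × X), IsOpen U ∧
          A = {G : Frag X | ((G.1 : Set (ℝ × X)) ∩ U).Nonempty}}),
        MeasurableSet (Φ ⁻¹' A) := by
      rintro A (⟨U, hU, rfl⟩ | ⟨U, hU, rfl⟩)
      · have h : Φ ⁻¹' {G : Frag X | (G.1 : Set (ℝ × X)) ⊆ U} =
            ⋃ n : ℕ, {G | (((Φ G).1 : Set (ℝ × X)) ∩
              Metric.thickening (1 / ((n : ℝ) + 1)) Uᶜ).Nonempty}ᶜ := by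
          ext G
          simp only [Set.mem_preimage, Set.mem_setOf_eq, Set.mem_iUnion, Set.mem_compl_iff]
          constructor
          · intro hsub
            obtain ⟨δ, hδ, hd⟩ := (Set.disjoint_compl_right_iff_subset.2 hsub).exists_thickenings
              (Φ G).1.isCompact hU.isClosed_compl
            obtain ⟨n, hn⟩ := exists_nat_one_div_lt hδ
            refine ⟨n, ?_⟩
            rintro ⟨p, hp, hpU⟩
            exact Set.disjoint_left.1 hd (Metric.self_subset_thickening hδ _ hp)
              (Metric.thickening_mono hn.le _ hpU)
          · rintro ⟨n, hn⟩ p hp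
            by_contra hpU
            exact hn ⟨p, hp, Metric.self_subset_thickening Nat.one_div_pos_of_nat _ hpU⟩
        rw [h]
        exact MeasurableSet.iUnion fun n => (hmeet _ Metric.isOpen_thickening).compl
      · exact hmeet U hU
    have := @measurable_generateFrom _ _ _ _ Φ key
    rwa [← Frag.borel_eq X] at this
  · have : closure ((G.1.1 : Set (ℝ × X)) ∩ {p : ℝ × X | p.2 ∈ E}) ⊆
        Prod.snd ⁻¹' closure E :=
      closure_minimal (fun q hq => subset_closure hq.2)
        (isClosed_closure.preimage continuous_snd)
    exact this hp
end

section
/- Let (X,d) be a separable metric space. Define the curve-fragment space Frag(X) := { G : G is a nonempty compact subset of ℝ × X, G ⊆ [0,1] × X, and d(x,y) ≤ |s−t| for all (s,x), (t,y) ∈ G }, equipped with the Hausdorff metric inherited from the space of nonempty compact subsets of ℝ × X. For G ∈ Frag(X) set dom(G) := { s : ∃x, (s,x) ∈ G }, and for t ∈ dom(G) let e(t,G) denote the unique x ∈ X with (t,x) ∈ G. Let Γ̄(X) := { (t,G) ∈ ℝ × Frag(X) : t ∈ dom(G) }. Then the set MD := { (t,G) ∈ Γ̄(X) : t is a limit point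 of dom(G) and the limit lim_{dom(G) ∋ s → t} d(e(s,G), e(t,G)) / |s−t| exists } is a Borel subset of ℝ × Frag(X), and the map on Γ̄(X) that sends (t,G) ∈ MD to this limit (the metric derivative of the fragment at t) and sends every other (t,G) ∈ Γ̄(X) to 0 is Borel measurable. -/
open Filter Topology TopologicalSpace MeasureTheory
open scoped Classical

/-- The (compact) domain of a fragment. -/
def Frag.domSet {X : Type*} [MetricSpace X] (G : Frag X) : Set ℝ :=
  {s : ℝ | ∃ x : X, (s, x) ∈ (G.1 : Set (ℝ × X))}

/-- Evaluation of a fragment: for `s ∈ dom G`, `G.eval s` is the unique `x` with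
`(s,x) ∈ G` (and a junk value otherwise). -/
noncomputable def Frag.eval {X : Type*} [MetricSpace X] (G : Frag X) (s : ℝ) : X :=
  if h : ∃ x : X, (s, x) ∈ (G.1 : Set (ℝ × X)) then h.choose
  else (G.1.nonempty.choose).2

lemma Frag.eval_eq {X : Type*} [MetricSpace X] (G : Frag X) {s : ℝ} {x : X}
    (h : (s, x) ∈ (G.1 : Set (ℝ × X))) : G.eval s = x := by
  have hex : ∃ x : X, (s, x) ∈ (G.1 : Set (ℝ × X)) := ⟨x, h⟩
  have h1 : G.eval s = hex.choose := by
    unfold Frag.eval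
    rw [dif_pos hex]
  rw [h1]
  have h2 := G.2.2 _ hex.choose_spec _ h
  simp only [sub_self, abs_zero] at h2
  exact dist_le_zero.1 h2

lemma Frag.eval_mem {X : Type*} [MetricSpace X] (G : Frag X) {s : ℝ}
    (h : s ∈ G.domSet) : (s, G.eval s) ∈ (G.1 : Set (ℝ × X)) := by
  obtain ⟨x, hx⟩ := h
  rw [G.eval_eq hx]; exact hx

lemma Frag.exists_near {X : Type*} [MetricSpace X] (G H : Frag X) {δ : ℝ}
    (h : dist G H < δ) {p : ℝ × X} (hp : p ∈ (G.1 : Set (ℝ × X))) :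
    ∃ q ∈ (H.1 : Set (ℝ × X)), dist p q < δ := by
  have h' : Metric.hausdorffDist (G.1 : Set (ℝ × X)) (H.1 : Set (ℝ × X)) < δ := h
  refine Metric.exists_dist_lt_of_hausdorffDist_lt hp h' ?_
  exact Metric.hausdorffEDist_ne_top_of_nonempty_of_bounded G.1.nonempty H.1.nonempty
    G.1.isCompact.isBounded H.1.isCompact.isBounded

/-- Existential quantification over a compact fragment preserves closedness. -/
lemma frag_closed {X : Type*} [MetricSpace X] (R : Set (ℝ × (ℝ × X) × (ℝ × X)))
    (hR : IsClosed R) :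
    IsClosed {p : ℝ × Frag X | ∃ a ∈ (p.2.1 : Set (ℝ × X)), ∃ b ∈ (p.2.1 : Set (ℝ × X)),
      (p.1, a, b) ∈ R} := by
  rw [← isOpen_compl_iff, Metric.isOpen_iff]
  rintro ⟨t, G⟩ h
  have hK : IsCompact (({t} : Set ℝ) ×ˢ ((G.1 : Set (ℝ × X)) ×ˢ (G.1 : Set (ℝ × X)))) :=
    isCompact_singleton.prod (G.1.isCompact.prod G.1.isCompact)
  have hsub : ({t} : Set ℝ) ×ˢ ((G.1 : Set (ℝ × X)) ×ˢ (G.1 : Set (ℝ × X))) ⊆ Rᶜ := by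
    rintro ⟨t', a, b⟩ ⟨ht, ha, hb⟩ hmem
    simp only [Set.mem_singleton_iff] at ht
    subst ht
    exact h ⟨a, ha, b, hb, hmem⟩
  obtain ⟨δ, hδ, hth⟩ := hK.exists_thickening_subset_open hR.isOpen_compl hsub
  refine ⟨δ, hδ, ?_⟩
  rintro ⟨t', H⟩ hH ⟨a, ha, b, hb, hmem⟩
  rw [Metric.mem_ball, Prod.dist_eq, max_lt_iff] at hH
  obtain ⟨a', ha', haa⟩ := H.exists_near G hH.2 ha
  obtain ⟨b', hb', hbb⟩ := H.exists_near G hH.2 hb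
  refine hth ?_ hmem
  rw [Metric.mem_thickening_iff]
  refine ⟨(t, a', b'), ⟨rfl, ha', hb'⟩, ?_⟩
  rw [Prod.dist_eq, Prod.dist_eq, max_lt_iff, max_lt_iff]
  exact ⟨hH.1, haa, hbb⟩

lemma frag_meas {X : Type*} [MetricSpace X] (R : Set ((ℝ × X) × (ℝ × X)))
    (hR : IsOpen R) :
    MeasurableSet[borel (ℝ × Frag X)] {p : ℝ × Frag X | ∃ a ∈ (p.2.1 : Set (ℝ × X)),
      ∃ b ∈ (p.2.1 : Set (ℝ × X)), a.1 = p.1 ∧ (a, b) ∈ R} := by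
  obtain ⟨C, hC, -, hU, -⟩ := hR.exists_iUnion_isClosed
  have : {p : ℝ × Frag X | ∃ a ∈ (p.2.1 : Set (ℝ × X)),
      ∃ b ∈ (p.2.1 : Set (ℝ × X)), a.1 = p.1 ∧ (a, b) ∈ R} =
      ⋃ n, {p : ℝ × Frag X | ∃ a ∈ (p.2.1 : Set (ℝ × X)), ∃ b ∈ (p.2.1 : Set (ℝ × X)),
      (p.1, a, b) ∈ {z : ℝ × (ℝ × X) × (ℝ × X) | z.2.1.1 = z.1 ∧ z.2 ∈ C n}} := by
    ext p
    simp only [← hU, Set.mem_ofPred_eq, Set.mem_iUnion]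
    constructor
    · rintro ⟨a, ha, b, hb, h, n, hn⟩
      exact ⟨n, a, ha, b, hb, h, hn⟩
    · rintro ⟨n, a, ha, b, hb, h, hn⟩
      exact ⟨a, ha, b, hb, h, n, hn⟩
  rw [this]
  letI : MeasurableSpace (ℝ × Frag X) := borel _
  haveI : BorelSpace (ℝ × Frag X) := ⟨rfl⟩
  refine MeasurableSet.iUnion fun n => (frag_closed _ ?_).measurableSet
  exact (isClosed_eq (by fun_prop) (by fun_prop)).inter ((hC n).preimage continuous_snd)

/-- The difference quotient. -/
noncomputable def fragQ {X : Type*} [MetricSpace X] (p : ℝ × Frag X) (s : ℝ) : ℝ :=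
  dist (p.2.eval s) (p.2.eval p.1) / |s - p.1|

/-- The points where the difference quotient frequently lies in `O`. -/
def fragFr {X : Type*} [MetricSpace X] (O : Set ℝ) : Set (ℝ × Frag X) :=
  {p | p.1 ∈ p.2.domSet ∧ ∃ᶠ s in 𝓝[p.2.domSet \ {p.1}] p.1, fragQ p s ∈ O}

lemma fragFr_meas {X : Type*} [MetricSpace X] (O : Set ℝ) (hO : IsOpen O) :
    MeasurableSet[borel (ℝ × Frag X)] (fragFr O : Set (ℝ × Frag X)) := by
  have key : (fragFr O : Set (ℝ × Frag X)) = ⋂ n : ℕ,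
      {p : ℝ × Frag X | ∃ a ∈ (p.2.1 : Set (ℝ × X)),
      ∃ b ∈ (p.2.1 : Set (ℝ × X)), a.1 = p.1 ∧ (a, b) ∈
        {z : (ℝ × X) × (ℝ × X) | (|z.2.1 - z.1.1| ≠ 0 ∧ |z.2.1 - z.1.1| < 1 / ((n : ℝ) + 1)) ∧
          dist z.2.2 z.1.2 / |z.2.1 - z.1.1| ∈ O}} := by
    ext ⟨t, G⟩
    simp only [fragFr, Set.mem_iInter, Set.mem_ofPred_eq]
    constructor
    · rintro ⟨ht, hf⟩ n
      have hpos : (0:ℝ) < 1 / ((n : ℝ) + 1) := Nat.one_div_pos_of_nat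
      have hev : ∀ᶠ s in 𝓝[G.domSet \ {t}] t, s ∈ G.domSet \ {t} ∧
          |s - t| < 1 / ((n : ℝ) + 1) := by
        refine eventually_mem_nhdsWithin.and (eventually_nhdsWithin_of_eventually_nhds ?_)
        exact Metric.ball_mem_nhds t hpos
      obtain ⟨s, hs, ⟨hsd, hst⟩, hlt⟩ := (hf.and_eventually hev).exists
      refine ⟨_, G.eval_mem ht, _, G.eval_mem hsd, rfl, ⟨?_, hlt⟩, hs⟩
      simpa [sub_eq_zero] using hst
    · intro h
      refine ⟨?_, ?_⟩
      · obtain ⟨⟨a1, a2⟩, ha, b, hb, rfl, -⟩ := h 0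
        exact ⟨a2, ha⟩
      · rw [Filter.frequently_iff]
        intro U hU
        obtain ⟨ε, hε, hsub⟩ := Metric.mem_nhdsWithin_iff.1 hU
        obtain ⟨n, hn⟩ := exists_nat_one_div_lt hε
        obtain ⟨⟨a1, a2⟩, ha, ⟨b1, b2⟩, hb, rfl, ⟨h0, h1⟩, h2⟩ := h n
        refine ⟨b1, hsub ⟨?_, ⟨b2, hb⟩, ?_⟩, ?_⟩
        · rw [Metric.mem_ball, Real.dist_eq]
          exact h1.trans hn
        · simpa [sub_eq_zero] using h0
        · simp only [fragQ, G.eval_eq ha, G.eval_eq hb]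
          exact h2
  rw [key]
  refine MeasurableSet.iInter fun n => frag_meas _ ?_
  have hopen : IsOpen {z : (ℝ × X) × (ℝ × X) |
      |z.2.1 - z.1.1| ≠ 0 ∧ |z.2.1 - z.1.1| < 1 / ((n : ℝ) + 1)} :=
    IsOpen.and
      (isOpen_ne_fun (f := fun z : (ℝ × X) × (ℝ × X) => |z.2.1 - z.1.1|) (g := fun _ => 0)
        (by fun_prop) (by fun_prop))
      (isOpen_lt (f := fun z : (ℝ × X) × (ℝ × X) => |z.2.1 - z.1.1|)
        (g := fun _ => 1 / ((n : ℝ) + 1)) (by fun_prop) (by fun_prop))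
  have hcont : ContinuousOn (fun z : (ℝ × X) × (ℝ × X) => dist z.2.2 z.1.2 / |z.2.1 - z.1.1|)
      {z : (ℝ × X) × (ℝ × X) |
      |z.2.1 - z.1.1| ≠ 0 ∧ |z.2.1 - z.1.1| < 1 / ((n : ℝ) + 1)} := by
    refine ContinuousOn.div (by fun_prop) (by fun_prop) fun z hz => hz.1
  exact hcont.isOpen_inter_preimage hopen hO

lemma fragQ_bdd {X : Type*} [MetricSpace X] (p : ℝ × Frag X) (hp : p.1 ∈ p.2.domSet) :
    ∀ᶠ s in 𝓝[p.2.domSet \ {p.1}] p.1, 0 ≤ fragQ p s ∧ fragQ p s ≤ 1 := by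
  filter_upwards [eventually_mem_nhdsWithin] with s hs
  refine ⟨div_nonneg dist_nonneg (abs_nonneg _), div_le_one_of_le₀ ?_ (abs_nonneg _)⟩
  exact p.2.2.2 _ (p.2.eval_mem hs.1) _ (p.2.eval_mem hp)

/-- The set where the metric derivative exists. -/
def fragMD (X : Type*) [MetricSpace X] : Set (ℝ × Frag X) :=
  {p | p.1 ∈ p.2.domSet ∧ (𝓝[p.2.domSet \ {p.1}] p.1).NeBot ∧
        ∃ l : ℝ, Tendsto (fragQ p) (𝓝[p.2.domSet \ {p.1}] p.1) (𝓝 l)}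

lemma fragMD_meas (X : Type*) [MetricSpace X] :
    MeasurableSet[borel (ℝ × Frag X)] (fragMD X) := by
  have key : fragMD X = fragFr Set.univ ∩ ⋂ a : ℚ, ⋂ b : ℚ, ⋂ _ : a < b,
      (fragFr (Set.Iio (a : ℝ)) ∩ fragFr (Set.Ioi (b : ℝ)))ᶜ := by
    ext p
    simp only [fragMD, fragFr, Set.mem_inter_iff, Set.mem_iInter, Set.mem_ofPred_eq,
      Set.mem_compl_iff, Set.mem_univ, Filter.frequently_true_iff_neBot, Set.mem_Iio,
      Set.mem_Ioi]
    constructor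
    · rintro ⟨h1, h2, l, hl⟩
      refine ⟨⟨h1, h2⟩, ?_⟩
      rintro a b hab ⟨⟨-, ha⟩, ⟨-, hb⟩⟩
      have hla : l ≤ a := le_of_tendsto_of_frequently hl (ha.mono fun _ h => h.le)
      have hlb : (b : ℝ) ≤ l := ge_of_tendsto_of_frequently hl (hb.mono fun _ h => h.le)
      have : (b : ℝ) ≤ a := hlb.trans hla
      exact absurd hab (not_lt.2 (by exact_mod_cast this))
    · rintro ⟨⟨h1, h2⟩, h⟩
      refine ⟨h1, h2, ?_⟩
      refine tendsto_of_no_upcrossings (s := Set.range ((↑) : ℚ → ℝ))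
        Rat.isDenseEmbedding_coe_real.dense ?_ ?_ ?_
      · rintro _ ⟨a, rfl⟩ _ ⟨b, rfl⟩ hab ⟨ha, hb⟩
        exact h a b (by exact_mod_cast hab) ⟨⟨h1, ha⟩, ⟨h1, hb⟩⟩
      · exact ⟨1, by
          rw [Filter.eventually_map]
          exact (fragQ_bdd p h1).mono fun _ h => h.2⟩
      · exact ⟨0, by
          rw [Filter.eventually_map]
          exact (fragQ_bdd p h1).mono fun _ h => h.1⟩
  rw [key]
  refine (fragFr_meas _ isOpen_univ).inter ?_
  refine MeasurableSet.iInter fun a => MeasurableSet.iInter fun b => MeasurableSet.iInter fun _ => ?_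
  exact ((fragFr_meas _ isOpen_Iio).inter (fragFr_meas _ isOpen_Ioi)).compl

/-- metric-derivative part of Lemma 6.1 of the paper.
Let `X` be separable.  Then the set `MD` of pairs `(t,G) ∈ Γ̄(X)` such that `t` is a limit point
of `dom G` and the metric derivative `lim_{dom G ∋ s → t} d(G(s),G(t))/|s−t|` exists is a Borel
subset of `ℝ × Frag X`, and the map on `Γ̄(X)` equal to this limit on `MD` and `0` elsewhere is
Borel measurable. -/
theorem metric_derivative_borel
    {X : Type*} [MetricSpace X] [SeparableSpace X] :
    MeasurableSet[borel (ℝ × Frag X)]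
      {p : ℝ × Frag X | p.1 ∈ p.2.domSet ∧ (𝓝[p.2.domSet \ {p.1}] p.1).NeBot ∧
        ∃ l : ℝ, Tendsto (fun s : ℝ => dist (p.2.eval s) (p.2.eval p.1) / |s - p.1|)
          (𝓝[p.2.domSet \ {p.1}] p.1) (𝓝 l)} ∧
    ∃ F : {p : ℝ × Frag X // p.1 ∈ p.2.domSet} → ℝ,
      (∀ p : {p : ℝ × Frag X // p.1 ∈ p.2.domSet},
        ((𝓝[p.1.2.domSet \ {p.1.1}] p.1.1).NeBot ∧
          ∃ l : ℝ, Tendsto (fun s : ℝ => dist (p.1.2.eval s) (p.1.2.eval p.1.1) / |s - p.1.1|)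
            (𝓝[p.1.2.domSet \ {p.1.1}] p.1.1) (𝓝 l)) →
        Tendsto (fun s : ℝ => dist (p.1.2.eval s) (p.1.2.eval p.1.1) / |s - p.1.1|)
          (𝓝[p.1.2.domSet \ {p.1.1}] p.1.1) (𝓝 (F p))) ∧
      (∀ p : {p : ℝ × Frag X // p.1 ∈ p.2.domSet},
        ¬((𝓝[p.1.2.domSet \ {p.1.1}] p.1.1).NeBot ∧
          ∃ l : ℝ, Tendsto (fun s : ℝ => dist (p.1.2.eval s) (p.1.2.eval p.1.1) / |s - p.1.1|)
            (𝓝[p.1.2.domSet \ {p.1.1}] p.1.1) (𝓝 l)) → F p = 0) ∧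
      @Measurable _ _ (MeasurableSpace.comap Subtype.val (borel (ℝ × Frag X)))
        Real.measurableSpace F := by
  refine ⟨fragMD_meas X, ?_⟩
  have hlim : ∀ p : {p : ℝ × Frag X // p.1 ∈ p.2.domSet}, ∃ l : ℝ,
      (p.1 ∈ fragMD X → Tendsto (fragQ p.1) (𝓝[p.1.2.domSet \ {p.1.1}] p.1.1) (𝓝 l)) ∧
      (p.1 ∉ fragMD X → l = 0) := by
    intro p
    by_cases h : p.1 ∈ fragMD X
    · obtain ⟨l, hl⟩ := h.2.2
      exact ⟨l, fun _ => hl, fun h' => absurd h h'⟩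
    · exact ⟨0, fun h' => absurd h' h, fun _ => rfl⟩
  choose F hF1 hF2 using hlim
  refine ⟨F, fun p hp => hF1 p ⟨p.2, hp⟩, fun p hp => hF2 p fun h => hp h.2, ?_⟩
  let _ : MeasurableSpace {p : ℝ × Frag X // p.1 ∈ p.2.domSet} :=
    MeasurableSpace.comap Subtype.val (borel (ℝ × Frag X))
  refine measurable_of_Ioi (f := F) fun c => ?_
  refine ⟨(fragMD X ∩ ⋃ b : ℚ, ⋃ _ : c < (b : ℝ), fragFr (Set.Ioi (b : ℝ))) ∪
    ((fragMD X)ᶜ ∩ {_p | c < 0}), ?_, ?_⟩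
  · refine ((fragMD_meas X).inter ?_).union ((fragMD_meas X).compl.inter
      (MeasurableSet.const _))
    exact MeasurableSet.iUnion fun b => MeasurableSet.iUnion fun _ => fragFr_meas _ isOpen_Ioi
  · ext p
    simp only [Set.mem_preimage, Set.mem_union, Set.mem_inter_iff, Set.mem_iUnion,
      Set.mem_compl_iff, Set.mem_ofPred_eq, Set.mem_Ioi]
    by_cases h : p.1 ∈ fragMD X
    · have hl := hF1 p h
      haveI := h.2.1
      simp only [h, true_and, not_true_eq_false, false_and, or_false]
      constructor
      · rintro ⟨b, hcb, -, hb⟩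
        exact hcb.trans_le (ge_of_tendsto_of_frequently hl (hb.mono fun _ h => le_of_lt h))
      · intro hc
        obtain ⟨b, hb1, hb2⟩ := exists_rat_btwn hc
        exact ⟨b, hb1, p.2, (hl.eventually (lt_mem_nhds hb2)).frequently⟩
    · simp [h, hF2 p h]
end
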